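/- Set Θ₁(θ₂⁺) = −(σ₁₂θ₂⁺ + μ₁)/σ₁₁. Then: (i) if Θ₁(θ₂⁺) ≤ 0, then w(θ₂) ≠ w(0) for every θ₂ ∈ ℂ∖[θ₂⁺, ∞) with θ₂ ≠ 0; (ii) if Θ₁(θ₂⁺) > 0, then −2μ₂/σ₂₂ ∈ (0, θ₂⁺), w(−2μ₂/σ₂₂) = w(0), w′(−2μ₂/σ₂₂) ≠ 0, and every θ₂ ∈ ℂ∖[θ₂⁺, ∞) with θ₂ ≠ 0 and w(θ₂) = w(0) is real and lies in the interval [−2μ₂/σ₂₂, θ₂⁺). -/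

import Mathlib

/-- The cut plane `ℂ ∖ (−∞, −1]`. -/
def cutC : Set ℂ := {z : ℂ | z.im = 0 ∧ z.re ≤ -1}ᶜ

/-- `T` is an analytic function on the cut plane `ℂ ∖ (−∞, −1]` agreeing with
`x ↦ cos (a · arccos x)` on `(−1, 1]`. -/
def IsChebyshev (a : ℝ) (T : ℂ → ℂ) : Prop :=
  (∀ z ∈ cutC, DifferentiableAt ℂ T z) ∧
  ∀ x : ℝ, x ∈ Set.Ioc (-1 : ℝ) 1 → T (x : ℂ) = ((Real.cos (a * Real.arccos x) : ℝ) : ℂ)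

/-- The affine map `χ(θ₂) = −(2θ₂ − (θ₂⁺+θ₂⁻))/(θ₂⁺−θ₂⁻)`. -/
noncomputable def chiMap (θ2p θ2m : ℝ) (θ : ℂ) : ℂ :=
  -(2 * θ - ((θ2p : ℂ) + (θ2m : ℂ))) / ((θ2p : ℂ) - (θ2m : ℂ))

theorem mem_cutC_iff {z : ℂ} : z ∈ cutC ↔ ¬ (z.im = 0 ∧ z.re ≤ -1) := Iff.rfl

theorem cos_mem_cutC {s : ℂ} (h1 : -Real.pi < s.re) (h2 : s.re < Real.pi) :
    Complex.cos s ∈ cutC := by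
  rw [mem_cutC_iff, Complex.cos_eq]
  simp only [← Complex.ofReal_cos, ← Complex.ofReal_sin, ← Complex.ofReal_cosh,
    ← Complex.ofReal_sinh]
  rintro ⟨him, hre⟩
  simp only [Complex.sub_im, Complex.sub_re, Complex.mul_im, Complex.mul_re, Complex.ofReal_re,
    Complex.ofReal_im, Complex.I_re, Complex.I_im, mul_zero, zero_mul, mul_one, add_zero,
    sub_zero, zero_sub, neg_eq_zero, mul_eq_zero] at him hre
  rcases him with h | h
  · rw [(Real.sin_eq_zero_iff_of_lt_of_lt h1 h2).1 h, Real.cos_zero] at hre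
    linarith [Real.one_le_cosh s.im]
  · rw [Real.sinh_eq_zero.1 h, Real.cosh_zero, mul_one] at hre
    have h3 : Real.cos Real.pi < Real.cos |s.re| :=
      Real.cos_lt_cos_of_nonneg_of_le_pi (abs_nonneg _) le_rfl (abs_lt.2 ⟨h1, h2⟩)
    rw [Real.cos_pi, Real.cos_abs] at h3
    linarith

theorem exists_cos_eq_of_mem_cutC {z : ℂ} (hz : z ∈ cutC) :
    ∃ s : ℂ, 0 ≤ s.re ∧ s.re < Real.pi ∧ Complex.cos s = z := by
  obtain ⟨t, rfl⟩ := Complex.cos_surjective z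
  have hp := Real.pi_pos
  obtain ⟨k, ⟨hk1, hk2⟩, -⟩ :=
    existsUnique_add_zsmul_mem_Ico (by positivity : 0 < 2 * Real.pi) t.re (-Real.pi)
  simp only [zsmul_eq_mul] at hk1 hk2
  set u : ℂ := t + k * (2 * Real.pi) with hu
  have hure : u.re = t.re + k * (2 * Real.pi) := by simp [hu]
  have hcu : Complex.cos u = Complex.cos t := Complex.cos_add_int_mul_two_pi t k
  rw [← hure] at hk1 hk2
  rw [← hcu] at hz ⊢
  rcases hk1.lt_or_eq with h | h
  · rcases le_total 0 u.re with h0 | h0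
    · exact ⟨u, h0, by linarith, rfl⟩
    · exact ⟨-u, by simpa using h0, by simp only [Complex.neg_re]; linarith, Complex.cos_neg u⟩
  · refine absurd hz ?_
    rw [mem_cutC_iff, not_not, Complex.cos_eq, ← h]
    simp only [← Complex.ofReal_cos, ← Complex.ofReal_sin, ← Complex.ofReal_cosh,
      ← Complex.ofReal_sinh]
    simp [Real.one_le_cosh]

/-- A generalized Chebyshev function satisfies `T (cos s) = cos (a s)` on the strip
`-π < re s < π`. -/
theorem IsChebyshev.apply_cos {a : ℝ} {T : ℂ → ℂ} (hT : IsChebyshev a T) {s : ℂ}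
    (h1 : -Real.pi < s.re) (h2 : s.re < Real.pi) :
    T (Complex.cos s) = Complex.cos (a * s) := by
  have hp := Real.pi_pos
  set U : Set ℂ := Complex.re ⁻¹' Set.Ioo (-Real.pi) Real.pi with hU
  have hUo : IsOpen U := isOpen_Ioo.preimage Complex.continuous_re
  have hUc : IsPreconnected U :=
    ((convex_Ioo (-Real.pi) Real.pi).linear_preimage Complex.reLm).isPreconnected
  have hf : AnalyticOnNhd ℂ (fun s => T (Complex.cos s)) U :=
    DifferentiableOn.analyticOnNhd (fun s hs =>
      ((hT.1 _ (cos_mem_cutC hs.1 hs.2)).comp s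
        Complex.differentiable_cos.differentiableAt).differentiableWithinAt) hUo
  have hg : AnalyticOnNhd ℂ (fun s : ℂ => Complex.cos (a * s)) U :=
    DifferentiableOn.analyticOnNhd (by fun_prop) hUo
  have hreal : ∀ x ∈ Set.Ioo 0 Real.pi,
      T (Complex.cos (x : ℂ)) = Complex.cos (a * (x : ℂ)) := by
    intro x hx
    have hc : Real.cos Real.pi < Real.cos x :=
      Real.cos_lt_cos_of_nonneg_of_le_pi hx.1.le le_rfl hx.2
    rw [Real.cos_pi] at hc
    rw [← Complex.ofReal_cos, hT.2 _ ⟨hc, Real.cos_le_one x⟩,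
      Real.arccos_cos hx.1.le hx.2.le]
    push_cast
    rfl
  have hfreq : ∃ᶠ z in nhdsWithin (((Real.pi / 2 : ℝ)) : ℂ) {((Real.pi / 2 : ℝ) : ℂ)}ᶜ,
      T (Complex.cos z) = Complex.cos (a * z) := by
    have ht : Filter.Tendsto (fun x : ℝ => (x : ℂ))
        (nhdsWithin (Real.pi / 2) {Real.pi / 2}ᶜ)
        (nhdsWithin (((Real.pi / 2 : ℝ)) : ℂ) {((Real.pi / 2 : ℝ) : ℂ)}ᶜ) := by
      refine Complex.continuous_ofReal.continuousAt.continuousWithinAt.tendsto_nhdsWithin ?_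
      intro x hx
      simpa only [Set.mem_compl_iff, Set.mem_singleton_iff, Complex.ofReal_inj] using hx
    refine ht.frequently (Filter.Eventually.frequently ?_)
    filter_upwards [mem_nhdsWithin_of_mem_nhds
      (Ioo_mem_nhds (by positivity : 0 < Real.pi / 2) (by linarith : Real.pi / 2 < Real.pi))]
      with x hx using hreal x hx
  exact hf.eqOn_of_preconnected_of_frequently_eq hg hUc
    (show ((Real.pi / 2 : ℝ) : ℂ) ∈ U from ⟨by simp only [Complex.ofReal_re]; linarith,
      by simp only [Complex.ofReal_re]; linarith⟩) hfreq ⟨h1, h2⟩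

theorem IsChebyshev.deriv_cos_ne_zero {a : ℝ} {T : ℂ → ℂ} (hT : IsChebyshev a T) {s : ℂ}
    (h1 : -Real.pi < s.re) (h2 : s.re < Real.pi) (ha : a ≠ 0) (hs : Complex.sin (a * s) ≠ 0) :
    deriv T (Complex.cos s) ≠ 0 := by
  intro h0
  have hd : HasDerivAt T 0 (Complex.cos s) := by
    simpa only [h0] using (hT.1 _ (cos_mem_cutC h1 h2)).hasDerivAt
  have hl : HasDerivAt (fun s => T (Complex.cos s)) (0 * -Complex.sin s) s :=
    hd.comp s (Complex.hasDerivAt_cos s)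
  have hr : HasDerivAt (fun s : ℂ => Complex.cos (a * s)) (-Complex.sin (a * s) * (a * 1)) s :=
    ((hasDerivAt_id s).const_mul (a : ℂ)).ccos
  have hev : (fun s => T (Complex.cos s)) =ᶠ[nhds s] fun s : ℂ => Complex.cos (a * s) := by
    filter_upwards [(isOpen_Ioo.preimage Complex.continuous_re).mem_nhds
      (show s ∈ Complex.re ⁻¹' Set.Ioo (-Real.pi) Real.pi from ⟨h1, h2⟩)] with z hz
    exact hT.apply_cos hz.1 hz.2
  have := (hl.congr_of_eventuallyEq hev.symm).unique hr
  rw [zero_mul, mul_one, eq_comm, mul_eq_zero, neg_eq_zero, Complex.ofReal_eq_zero] at this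
  exact this.elim hs ha

/-- Solutions of `cos (π s / β) = cos (π s₀ / β)` in the half-plane `0 ≤ re s`, other than
`s = s₀`, are real and at least `2β - s₀`. -/
theorem two_mul_sub_le_re_of_cos_eq {β s0 : ℝ} (hs0 : 0 < s0) (hβ : s0 < β) {s : ℂ}
    (hs : 0 ≤ s.re) (hne : s ≠ s0)
    (h : Complex.cos ((Real.pi / β : ℝ) * s) = Complex.cos ((Real.pi / β : ℝ) * s0)) :
    s = (s.re : ℂ) ∧ 2 * β - s0 ≤ s.re := by
  have hβ0 : 0 < β := hs0.trans hβ
  have hβc : (β : ℂ) ≠ 0 := by exact_mod_cast hβ0.ne'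
  have hpc : (Real.pi : ℂ) ≠ 0 := by exact_mod_cast Real.pi_ne_zero
  obtain ⟨k, hk⟩ := Complex.cos_eq_cos_iff.1 h.symm
  push_cast at hk
  have key : s = ((2 * k * β + s0 : ℝ) : ℂ) ∨ s = ((2 * k * β - s0 : ℝ) : ℂ) := by
    refine hk.imp (fun hk => ?_) (fun hk => ?_) <;>
    · field_simp at hk
      push_cast
      linear_combination hk
  rcases key with rfl | rfl
  · refine ⟨by simp only [Complex.ofReal_re], ?_⟩
    rw [Complex.ofReal_re] at hs ⊢
    have hk0 : k ≠ 0 := by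
      rintro rfl
      simp at hne
    rcases lt_or_gt_of_ne hk0 with hk | hk
    · have : (k : ℝ) ≤ -1 := by exact_mod_cast Int.le_sub_one_of_lt hk
      nlinarith
    · have : (1 : ℝ) ≤ k := by exact_mod_cast hk
      nlinarith
  · refine ⟨by simp only [Complex.ofReal_re], ?_⟩
    rw [Complex.ofReal_re] at hs ⊢
    rcases le_or_gt k 0 with hk | hk
    · have : (k : ℝ) ≤ 0 := by exact_mod_cast hk
      nlinarith
    · have : (1 : ℝ) ≤ k := by exact_mod_cast hk
      nlinarith

/-- The angle `β` and the angle `s₀` of the origin on the ellipse: bounds, the position of the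
reflected angle `2β - s₀` relative to `π`, and its cosine. -/
theorem uniformization_angles {σ11 σ12 σ22 μ1 μ2 D B R : ℝ}
    (h11 : 0 < σ11) (h22 : 0 < σ22) (hD : D = σ11 * σ22 - σ12 ^ 2) (hD0 : 0 < D)
    (hμ1 : μ1 < 0) (hμ2 : μ2 < 0) (hB : B = μ1 * σ12 - μ2 * σ11)
    (hR : R = Real.sqrt (B ^ 2 + μ1 ^ 2 * D)) :
    ∃ s0 : ℝ, 0 < s0 ∧ s0 < Real.arccos (-σ12 / Real.sqrt (σ11 * σ22)) ∧
      Real.cos s0 = B / R ∧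
      Real.cos (2 * Real.arccos (-σ12 / Real.sqrt (σ11 * σ22)) - s0) =
        (B - D * (-2 * μ2 / σ22)) / R ∧
      (σ12 * (B + R) + μ1 * D < 0 ↔
        2 * Real.arccos (-σ12 / Real.sqrt (σ11 * σ22)) - s0 < Real.pi) := by
  have hμ1D : 0 < μ1 ^ 2 * D := by have := sq_pos_of_neg hμ1; positivity
  have hR0 : 0 < R := by rw [hR]; positivity
  have hR2 : R ^ 2 = B ^ 2 + μ1 ^ 2 * D := by rw [hR, Real.sq_sqrt (by positivity)]
  have hp : 0 < σ11 * σ22 := by positivity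
  set q := Real.sqrt (σ11 * σ22) with hq
  have hq0 : 0 < q := Real.sqrt_pos.2 hp
  have hq2 : q ^ 2 = σ11 * σ22 := Real.sq_sqrt hp.le
  set d := Real.sqrt D with hd
  have hd0 : 0 < d := Real.sqrt_pos.2 hD0
  have hd2 : d ^ 2 = D := Real.sq_sqrt hD0.le
  have hcB : |B / R| < 1 := by
    rw [← sq_lt_one_iff_abs_lt_one, div_pow, div_lt_one (by positivity)]
    linarith
  have hcσ : |-σ12 / q| < 1 := by
    rw [← sq_lt_one_iff_abs_lt_one, div_pow, div_lt_one (by positivity)]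
    linarith
  rw [abs_lt] at hcB hcσ
  set β := Real.arccos (-σ12 / q) with hβ
  set s0 := Real.arccos (B / R) with hs0
  have cβ : Real.cos β = -σ12 / q := Real.cos_arccos hcσ.1.le hcσ.2.le
  have cs : Real.cos s0 = B / R := Real.cos_arccos hcB.1.le hcB.2.le
  have sβ : Real.sin β = d / q := by
    rw [hβ, Real.sin_arccos, Real.sqrt_eq_iff_mul_self_eq_of_pos (by positivity)]
    field_simp
    linarith
  have ss : Real.sin s0 = -μ1 * d / R := by
    rw [hs0, Real.sin_arccos, Real.sqrt_eq_iff_mul_self_eq_of_pos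
      (div_pos (mul_pos (neg_pos.2 hμ1) hd0) hR0)]
    field_simp
    rw [hR2, hd2]
    ring
  have hs0pos : 0 < s0 := Real.arccos_pos.2 hcB.2
  have hβpi : β ≤ Real.pi := Real.arccos_le_pi _
  have hs0pi : s0 ≤ Real.pi := Real.arccos_le_pi _
  have hβ0 : 0 ≤ β := Real.arccos_nonneg _
  have hlt : s0 < β := by
    by_contra! hle
    have h1 : Real.sin (β - s0) ≤ 0 :=
      Real.sin_nonpos_of_nonpos_of_neg_pi_le (by linarith) (by linarith)
    have h2 : Real.sin (β - s0) = d * (-μ2 * σ11) / (q * R) := by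
      rw [Real.sin_sub, cβ, cs, sβ, ss, hB]
      field_simp
      ring
    have h3 : 0 < d * (-μ2 * σ11) / (q * R) :=
      div_pos (mul_pos hd0 (mul_pos (neg_pos.2 hμ2) h11)) (by positivity)
    linarith
  refine ⟨s0, hs0pos, hlt, cs, ?_, ?_⟩
  · rw [Real.cos_sub, Real.cos_two_mul, Real.sin_two_mul, cβ, cs, sβ, ss]
    field_simp
    rw [hq2, hd2, hB, hD]
    ring
  · have h1 : Real.cos (β - s0) - Real.cos (Real.pi - β) =
        -(σ12 * (B + R) + μ1 * D) / (q * R) := by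
      rw [Real.cos_pi_sub, Real.cos_sub, cβ, cs, sβ, ss, ← hd2]
      field_simp
      ring
    have h2 : Real.cos (Real.pi - β) < Real.cos (β - s0) ↔ β - s0 < Real.pi - β :=
      Real.strictAntiOn_cos.lt_iff_gt ⟨by linarith, by linarith⟩ ⟨by linarith, by linarith⟩
    rw [← sub_pos, h1, div_pos_iff_of_pos_right (by positivity), neg_pos] at h2
    rw [h2]
    constructor <;> intro h <;> linarith

theorem chiMap_eq {B R D : ℝ} (hD : D ≠ 0) (hR : R ≠ 0) (θ : ℂ) :
    chiMap ((B + R) / D) ((B - R) / D) θ = (B - D * θ) / R := by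
  have hDc : (D : ℂ) ≠ 0 := by exact_mod_cast hD
  have hRc : (R : ℂ) ≠ 0 := by exact_mod_cast hR
  have h : ((((B + R) / D : ℝ) : ℂ) - (((B - R) / D : ℝ) : ℂ)) = 2 * R / D := by
    push_cast
    field_simp
    ring
  rw [chiMap, h]
  push_cast
  field_simp
  ring

theorem affine_mem_cutC {B R D : ℝ} (hD : 0 < D) (hR : 0 < R) {θ : ℂ}
    (hθ : ¬ (θ.im = 0 ∧ (B + R) / D ≤ θ.re)) : ((B : ℂ) - D * θ) / R ∈ cutC := by
  rw [mem_cutC_iff]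
  contrapose! hθ
  simp only [Complex.div_ofReal_im, Complex.div_ofReal_re, Complex.sub_im, Complex.sub_re,
    Complex.im_ofReal_mul, Complex.re_ofReal_mul, Complex.ofReal_im, Complex.ofReal_re,
    div_eq_zero_iff, hR.ne', or_false, zero_sub, neg_eq_zero, mul_eq_zero, hD.ne',
    false_or, div_le_iff₀ hR] at hθ ⊢
  refine ⟨hθ.1, ?_⟩
  rw [div_le_iff₀ hD]
  linarith [hθ.2]

/-- Location of the solutions of `w(θ₂) = w(0)` in the cut plane, according to the sign
of `Θ₁(θ₂⁺) = −(σ₁₂θ₂⁺ + μ₁)/σ₁₁`. -/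
theorem stmt16 (σ11 σ12 σ22 μ1 μ2 : ℝ)
    (h11 : 0 < σ11) (h22 : 0 < σ22) (hdet : 0 < σ11 * σ22 - σ12 ^ 2)
    (hμ1 : μ1 < 0) (hμ2 : μ2 < 0)
    (θ2p θ2m β : ℝ)
    (hθ2p : θ2p = ((μ1 * σ12 - μ2 * σ11) +
      Real.sqrt ((μ1 * σ12 - μ2 * σ11) ^ 2 + μ1 ^ 2 * (σ11 * σ22 - σ12 ^ 2))) /
      (σ11 * σ22 - σ12 ^ 2))
    (hθ2m : θ2m = ((μ1 * σ12 - μ2 * σ11) -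
      Real.sqrt ((μ1 * σ12 - μ2 * σ11) ^ 2 + μ1 ^ 2 * (σ11 * σ22 - σ12 ^ 2))) /
      (σ11 * σ22 - σ12 ^ 2))
    (hβ : β = Real.arccos (-σ12 / Real.sqrt (σ11 * σ22)))
    (T : ℂ → ℂ) (hT : IsChebyshev (Real.pi / β) T)
    (w : ℂ → ℂ) (hw : w = fun θ => T (chiMap θ2p θ2m θ))
    (Θ1θ2p : ℝ) (hΘ1 : Θ1θ2p = -(σ12 * θ2p + μ1) / σ11) :
    (Θ1θ2p ≤ 0 →
      ∀ θ ∈ ({z : ℂ | z.im = 0 ∧ θ2p ≤ z.re}ᶜ : Set ℂ), θ ≠ 0 → w θ ≠ w 0) ∧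
    (0 < Θ1θ2p →
      (0 < -2 * μ2 / σ22 ∧ -2 * μ2 / σ22 < θ2p) ∧
      w ((-2 * μ2 / σ22 : ℝ) : ℂ) = w 0 ∧
      deriv w ((-2 * μ2 / σ22 : ℝ) : ℂ) ≠ 0 ∧
      ∀ θ ∈ ({z : ℂ | z.im = 0 ∧ θ2p ≤ z.re}ᶜ : Set ℂ), θ ≠ 0 → w θ = w 0 →
        θ.im = 0 ∧ -2 * μ2 / σ22 ≤ θ.re ∧ θ.re < θ2p) := by
  set D := σ11 * σ22 - σ12 ^ 2 with hD
  set B := μ1 * σ12 - μ2 * σ11 with hB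
  set R := Real.sqrt (B ^ 2 + μ1 ^ 2 * D) with hR
  have hR0 : 0 < R := by
    have := sq_pos_of_neg hμ1
    rw [hR]
    positivity
  have hRc : (R : ℂ) ≠ 0 := by exact_mod_cast hR0.ne'
  have hDc : (D : ℂ) ≠ 0 := by exact_mod_cast hdet.ne'
  obtain ⟨s0, hs0, hs0β, cs0, cs1, hiff⟩ :=
    uniformization_angles h11 h22 hD hdet hμ1 hμ2 hB hR
  rw [← hβ] at hs0β cs1 hiff
  have hβ0 : 0 < β := hs0.trans hs0β
  have hβpi : β ≤ Real.pi := hβ ▸ Real.arccos_le_pi _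
  have hw' : w = fun θ : ℂ => T ((B - D * θ) / R) := by
    rw [hw, hθ2p, hθ2m]
    funext θ
    rw [chiMap_eq hdet.ne' hR0.ne']
  have hw0 : w 0 = Complex.cos ((Real.pi / β : ℝ) * (s0 : ℂ)) := by
    have h : ((B : ℂ) - D * 0) / R = Complex.cos (s0 : ℂ) := by
      rw [← Complex.ofReal_cos, cs0]
      push_cast
      ring
    rw [hw']
    beta_reduce
    rw [h, hT.apply_cos] <;> rw [Complex.ofReal_re] <;> linarith
  have hsol : ∀ θ ∈ ({z : ℂ | z.im = 0 ∧ θ2p ≤ z.re}ᶜ : Set ℂ), θ ≠ 0 → w θ = w 0 →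
      ∃ s : ℝ, 2 * β - s0 ≤ s ∧ s < Real.pi ∧ θ = (((B - R * Real.cos s) / D : ℝ) : ℂ) := by
    intro θ hθ hθ0 hθw
    rw [hθ2p] at hθ
    obtain ⟨s, hs1, hs2, hs⟩ := exists_cos_eq_of_mem_cutC (affine_mem_cutC hdet hR0 hθ)
    have hθs : θ = (B - R * Complex.cos s) / D := by
      rw [hs]
      field_simp
      ring
    have hws : w θ = Complex.cos ((Real.pi / β : ℝ) * s) := by
      rw [hw']
      beta_reduce
      rw [← hs, hT.apply_cos (by linarith [Real.pi_pos]) hs2]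
    rw [hws, hw0] at hθw
    have hne : s ≠ s0 := by
      rintro rfl
      apply hθ0
      rw [hθs, ← Complex.ofReal_cos, cs0]
      push_cast
      field_simp
      ring
    obtain ⟨hsr, hle⟩ := two_mul_sub_le_re_of_cos_eq hs0 hs0β hs1 hne hθw
    refine ⟨s.re, hle, hs2, ?_⟩
    push_cast
    rw [← hsr]
    exact hθs
  have hΘ : 0 < Θ1θ2p ↔ 2 * β - s0 < Real.pi := by
    rw [← hiff, hΘ1, div_pos_iff_of_pos_right h11, neg_pos, hθ2p]
    have : σ12 * ((B + R) / D) + μ1 = (σ12 * (B + R) + μ1 * D) / D := by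
      field_simp
    rw [this, div_lt_iff₀ hdet, zero_mul]
  refine ⟨fun hle θ hθ hθ0 hθw => ?_, fun hpos => ?_⟩
  · obtain ⟨s, hs1, hs2, -⟩ := hsol θ hθ hθ0 hθw
    exact hle.not_gt (hΘ.2 (by linarith))
  · have hs1 : 2 * β - s0 < Real.pi := hΘ.1 hpos
    have hx : -2 * μ2 / σ22 = (B - R * Real.cos (2 * β - s0)) / D := by
      rw [cs1]
      field_simp
      ring
    have hs1' : ((2 * β - s0 : ℝ) : ℂ).re < Real.pi := by rwa [Complex.ofReal_re]
    have hs1'' : -Real.pi < ((2 * β - s0 : ℝ) : ℂ).re := by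
      rw [Complex.ofReal_re]; linarith
    have hχ : ((B : ℂ) - D * ((-2 * μ2 / σ22 : ℝ) : ℂ)) / R =
        Complex.cos ((2 * β - s0 : ℝ) : ℂ) := by
      rw [← Complex.ofReal_cos, cs1]
      push_cast
      ring
    have hβc : (β : ℂ) ≠ 0 := by exact_mod_cast hβ0.ne'
    have hang : ((Real.pi / β : ℝ) : ℂ) * ((2 * β - s0 : ℝ) : ℂ) =
        2 * Real.pi - (Real.pi / β : ℝ) * (s0 : ℂ) := by
      push_cast
      field_simp
    have hlt : ∀ s : ℝ, 2 * β - s0 ≤ s → s < Real.pi →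
        (B - R * Real.cos s) / D < θ2p := by
      intro s h1 h2
      have hc : Real.cos Real.pi < Real.cos s :=
        Real.cos_lt_cos_of_nonneg_of_le_pi (by linarith) le_rfl h2
      rw [Real.cos_pi] at hc
      rw [hθ2p]
      gcongr
      nlinarith
    refine ⟨⟨div_pos (by linarith) h22, ?_⟩, ?_, ?_, fun θ hθ hθ0 hθw => ?_⟩
    · rw [hx]
      exact hlt _ le_rfl hs1
    · rw [hw0, hw']
      beta_reduce
      rw [hχ, hT.apply_cos hs1'' hs1', hang, Complex.cos_two_pi_sub]
    · have hsin : Complex.sin ((Real.pi / β : ℝ) * ((2 * β - s0 : ℝ) : ℂ)) ≠ 0 := by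
        rw [hang, Complex.sin_two_pi_sub, neg_ne_zero, ← Complex.ofReal_mul,
          ← Complex.ofReal_sin, Complex.ofReal_ne_zero]
        have hp := Real.pi_pos
        refine (Real.sin_pos_of_pos_of_lt_pi (by positivity) ?_).ne'
        rw [div_mul_eq_mul_div, div_lt_iff₀ hβ0]
        gcongr
      have hT' := hT.deriv_cos_ne_zero hs1'' hs1' (div_pos Real.pi_pos hβ0).ne' hsin
      have hTd := (hT.1 _ (cos_mem_cutC hs1'' hs1')).hasDerivAt
      rw [← hχ] at hT' hTd
      have haff : HasDerivAt (fun θ : ℂ => ((B : ℂ) - D * θ) / R) (-(D * 1) / R)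
          ((-2 * μ2 / σ22 : ℝ) : ℂ) :=
        (((hasDerivAt_id _).const_mul (D : ℂ)).const_sub (B : ℂ)).div_const (R : ℂ)
      have hwd := HasDerivAt.comp (((-2 * μ2 / σ22 : ℝ) : ℂ))
        (h := fun θ : ℂ => ((B : ℂ) - D * θ) / R) hTd haff
      change HasDerivAt (fun θ : ℂ => T (((B : ℂ) - D * θ) / R)) _ _ at hwd
      rw [← hw'] at hwd
      rw [hwd.deriv]
      exact mul_ne_zero hT' (div_ne_zero (neg_ne_zero.2 (by rwa [mul_one])) hRc)
    · obtain ⟨s, h1, h2, rfl⟩ := hsol θ hθ hθ0 hθw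
      refine ⟨Complex.ofReal_im _, ?_, ?_⟩
      · rw [Complex.ofReal_re, hx]
        have := Real.cos_le_cos_of_nonneg_of_le_pi (by linarith) h2.le h1
        gcongr
      · rw [Complex.ofReal_re]
        exact hlt s h1 h2
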